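/- There is an absolute constant C > 0 with the following property. Let r > 0, ρ > 0 with 0 < |ρ−r| ≤ r/4, let z, l ∈ [0,1], and set x = (r, 0, z) and y(φ) = (ρ cos φ, ρ sin φ, l). If 1 ≤ |ρ−r| ≤ r/4, then ∫₀^{2π} |G(x, y(φ))| dφ ≤ C / (r |ρ−r|). If 0 < |ρ−r| < 1, then ∫₀^{2π} |G(x, y(φ))| dφ ≤ (C/r) ln(2 + r/|ρ−r|). -/

import Mathlib

open Real

/-- The general term of the series defining the Green function of the Laplacian on
`ℝ² × [0,1]` with Dirichlet boundary conditions; `d = |x' − y'|`. -/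
noncomputable def greenTerm (d x3 y3 : ℝ) (n : ℤ) : ℝ :=
  1 / Real.sqrt (d ^ 2 + (x3 - y3 + 2 * (n : ℝ)) ^ 2)
    - 1 / Real.sqrt (d ^ 2 + (x3 + y3 - 2 * (n : ℝ)) ^ 2)

/-- The Green function of the Laplacian on `ℝ² × [0,1]` with Dirichlet boundary
conditions. -/
noncomputable def greenG (x' : EuclideanSpace ℝ (Fin 2)) (x3 : ℝ)
    (y' : EuclideanSpace ℝ (Fin 2)) (y3 : ℝ) : ℝ :=
  (1 / (4 * π)) * ∑' n : ℤ, greenTerm (‖x' - y'‖) x3 y3 n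

/-- The point of `ℝ²` (with the Euclidean norm) with coordinates `(a, b)`. -/
noncomputable def vec2 (a b : ℝ) : EuclideanSpace ℝ (Fin 2) :=
  (WithLp.equiv 2 (Fin 2 → ℝ)).symm ![a, b]

lemma gaux_telescope (c : ℝ) (hc : 0 < c) :
    HasSum (fun n : ℕ => 1 / ((c + n) * (c + n + 1))) (1 / c) := by
  rw [hasSum_iff_tendsto_nat_of_nonneg (fun n => by positivity)]
  have h : ∀ N : ℕ, ∑ n ∈ Finset.range N, 1 / ((c + n) * (c + n + 1)) = 1 / c - 1 / (c + N) := by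
    intro N
    induction N with
    | zero => simp
    | succ k ih =>
      rw [Finset.sum_range_succ, ih]
      push_cast
      have : c + k ≠ 0 := by positivity
      have : c + k + 1 ≠ 0 := by positivity
      have : c + (k + 1) ≠ 0 := by positivity
      field_simp
      ring
  simp_rw [h]
  have h2 : Filter.Tendsto (fun N : ℕ => 1 / (c + (N : ℝ))) Filter.atTop (nhds 0) := by
    simp_rw [one_div]
    exact Filter.Tendsto.inv_tendsto_atTop
      (Filter.tendsto_atTop_add_const_left _ _ tendsto_natCast_atTop_atTop)
  simpa using h2.const_sub (1 / c)

lemma gaux_tsum_int (g : ℤ → ℝ) (c K : ℝ) (hc : 0 < c) (hK : 0 ≤ K)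
    (h : ∀ n : ℤ, |g n| ≤ K * (1 / ((c + |(n : ℝ)|) * (c + |(n : ℝ)| + 1)))) :
    |∑' n, g n| ≤ 2 * K / c := by
  have h1 : HasSum (fun n : ℕ => K * (1 / ((c + n) * (c + n + 1)))) (K * (1 / c)) :=
    (gaux_telescope c hc).mul_left K
  have h2 := HasSum.of_nat_of_neg
    (f := fun n : ℤ => K * (1 / ((c + |(n : ℝ)|) * (c + |(n : ℝ)| + 1))))
    (g := K * (1 / c)) (g' := K * (1 / c)) (by simpa using h1) (by simpa using h1)
  have h3 := tsum_of_norm_bounded (f := g) h2 (by simpa using h)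
  rw [Real.norm_eq_abs] at h3
  refine h3.trans ?_
  have : 0 ≤ K * (1 / ((c + |((0:ℤ) : ℝ)|) * (c + |((0:ℤ) : ℝ)| + 1))) := by positivity
  have e : 2 * K / c = K * (1 / c) + K * (1 / c) := by ring
  rw [e]
  linarith

lemma gaux_abs_le (d u : ℝ) : |u| ≤ √(d ^ 2 + u ^ 2) :=
  Real.abs_le_sqrt (by nlinarith [sq_nonneg d])

lemma gaux_le (d u : ℝ) : d ≤ √(d ^ 2 + u ^ 2) :=
  Real.le_sqrt_of_sq_le (by nlinarith [sq_nonneg u])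

lemma gaux_lip (d u v : ℝ) (hd : 0 < d) :
    |√(d ^ 2 + u ^ 2) - √(d ^ 2 + v ^ 2)| ≤ |u - v| := by
  have hP := gaux_le d u
  have hQ := gaux_le d v
  have hu := gaux_abs_le d u
  have hv := gaux_abs_le d v
  have hP2 : √(d ^ 2 + u ^ 2) ^ 2 = d ^ 2 + u ^ 2 := Real.sq_sqrt (by positivity)
  have hQ2 : √(d ^ 2 + v ^ 2) ^ 2 = d ^ 2 + v ^ 2 := Real.sq_sqrt (by positivity)
  set P := √(d ^ 2 + u ^ 2)
  set Q := √(d ^ 2 + v ^ 2)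
  have hs : 0 < P + Q := by linarith
  have e : |P - Q| * (P + Q) = |u - v| * |u + v| := by
    have hh : |P - Q| * (P + Q) = |P - Q| * |P + Q| := by rw [abs_of_pos hs]
    rw [hh, ← abs_mul, ← abs_mul]
    congr 1
    linarith
  have : |u + v| ≤ P + Q := (abs_add_le u v).trans (by linarith)
  have h3 : |P - Q| * (P + Q) ≤ |u - v| * (P + Q) := by
    rw [e]; exact mul_le_mul_of_nonneg_left this (abs_nonneg _)
  exact le_of_mul_le_mul_right h3 hs

lemma gaux_diff1 (d u v : ℝ) (hd : 0 < d) :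
    |1 / √(d ^ 2 + u ^ 2) - 1 / √(d ^ 2 + v ^ 2)| ≤
      |u - v| / (√(d ^ 2 + u ^ 2) * √(d ^ 2 + v ^ 2)) := by
  have hP := hd.trans_le (gaux_le d u)
  have hQ := hd.trans_le (gaux_le d v)
  have hl := gaux_lip d u v hd
  set P := √(d ^ 2 + u ^ 2)
  set Q := √(d ^ 2 + v ^ 2)
  have e : 1 / P - 1 / Q = -(P - Q) / (P * Q) := by field_simp; ring
  rw [e, abs_div, abs_neg, abs_of_pos (mul_pos hP hQ)]
  gcongr

lemma gaux_diff2 (d s t : ℝ) (hd : 1 ≤ d) (ht : |t| ≤ 2) :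
    |1 / √(d ^ 2 + (s + t) ^ 2) + 1 / √(d ^ 2 + (s - t) ^ 2) - 2 / √(d ^ 2 + s ^ 2)| ≤
      24 / (d * (d ^ 2 + s ^ 2)) := by
  have hd0 : 0 < d := by linarith
  have hP := gaux_le d (s + t)
  have hM := gaux_le d (s - t)
  have hS := gaux_le d s
  have lP := gaux_lip d (s + t) s hd0
  have lM := gaux_lip d (s - t) s hd0
  have hP2 : √(d ^ 2 + (s + t) ^ 2) ^ 2 = d ^ 2 + (s + t) ^ 2 := Real.sq_sqrt (by positivity)
  have hM2 : √(d ^ 2 + (s - t) ^ 2) ^ 2 = d ^ 2 + (s - t) ^ 2 := Real.sq_sqrt (by positivity)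
  have hS2 : √(d ^ 2 + s ^ 2) ^ 2 = d ^ 2 + s ^ 2 := Real.sq_sqrt (by positivity)
  set P := √(d ^ 2 + (s + t) ^ 2)
  set M := √(d ^ 2 + (s - t) ^ 2)
  set S := √(d ^ 2 + s ^ 2)
  have hP0 : 0 < P := by linarith
  have hM0 : 0 < M := by linarith
  have hS0 : 0 < S := by linarith
  rw [show s + t - s = t by ring] at lP
  rw [show s - t - s = -t by ring, abs_neg] at lM
  have ht2 : t ^ 2 ≤ 4 := by
    have := abs_le.mp ht
    nlinarith
  have sP : (P - S) ^ 2 ≤ 4 := (sq_le_sq.mpr lP).trans ht2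
  have sM : (M - S) ^ 2 ≤ 4 := (sq_le_sq.mpr lM).trans ht2
  have h3P : S ≤ 3 * P := by have := abs_le.mp lP; linarith
  have h3M : S ≤ 3 * M := by have := abs_le.mp lM; linarith
  have hPM : S ^ 2 - t ^ 2 ≤ P * M := by
    refine (le_abs_self _).trans (abs_le_of_sq_le_sq ?_ (by positivity))
    rw [mul_pow, hP2, hM2, hS2]
    nlinarith [sq_nonneg (d * t)]
  have low : 2 * S ≤ P + M := by
    refine (le_abs_self _).trans (abs_le_of_sq_le_sq ?_ (by positivity))
    have e0 : (P + M) ^ 2 = P ^ 2 + M ^ 2 + 2 * (P * M) := by ring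
    rw [e0, hP2, hM2]
    linarith [show (2 * S) ^ 2 = 2 * (S ^ 2) + 2 * (d ^ 2 + s ^ 2) by rw [← hS2]; ring,
      show d ^ 2 + (s + t) ^ 2 + (d ^ 2 + (s - t) ^ 2) = 2 * (d ^ 2 + s ^ 2) + 2 * t ^ 2 by ring]
  have up : (P + M - 2 * S) * S ≤ 4 := by
    have e0 : (P + M - 2 * S) * S = (P ^ 2 + M ^ 2 - (P - S) ^ 2 - (M - S) ^ 2) / 2 - S ^ 2 := by
      ring
    have e1 : P ^ 2 + M ^ 2 = 2 * S ^ 2 + 2 * t ^ 2 := by rw [hP2, hM2, hS2]; ring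
    rw [e0, e1]
    linarith [sq_nonneg (P - S), sq_nonneg (M - S)]
  have e : 1 / P + 1 / M - 2 / S =
      ((P - S) ^ 2 * (S / P) + (M - S) ^ 2 * (S / M) - (P + M - 2 * S) * S) / (S * S ^ 2) := by
    field_simp
    ring
  have q1 : S / P ≤ 3 := by rw [div_le_iff₀ hP0]; exact h3P
  have q2 : S / M ≤ 3 := by rw [div_le_iff₀ hM0]; exact h3M
  have q1' : 0 < S / P := by positivity
  have q2' : 0 < S / M := by positivity
  have p1 : (P - S) ^ 2 * (S / P) ≤ 4 * 3 := mul_le_mul sP q1 q1'.le (by norm_num)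
  have p2 : (M - S) ^ 2 * (S / M) ≤ 4 * 3 := mul_le_mul sM q2 q2'.le (by norm_num)
  have p1' : 0 ≤ (P - S) ^ 2 * (S / P) := by positivity
  have p2' : 0 ≤ (M - S) ^ 2 * (S / M) := by positivity
  have up' : 0 ≤ (P + M - 2 * S) * S := mul_nonneg (by linarith) hS0.le
  rw [e, abs_div, abs_of_pos (show 0 < S * S ^ 2 by positivity), ← hS2]
  have : |(P - S) ^ 2 * (S / P) + (M - S) ^ 2 * (S / M) - (P + M - 2 * S) * S| ≤ 24 := by
    rw [abs_le]; constructor <;> linarith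
  gcongr

/-- Pointwise bound at large distance. -/
lemma gaux_large (d z l : ℝ) (hz : z ∈ Set.Icc (0:ℝ) 1) (hl : l ∈ Set.Icc (0:ℝ) 1)
    (hd : 1 ≤ d) : |∑' n : ℤ, greenTerm d z l n| ≤ 192 / d ^ 2 := by
  obtain ⟨hz0, hz1⟩ := hz
  obtain ⟨hl0, hl1⟩ := hl
  have hd0 : 0 < d := by linarith
  by_cases hs : Summable (fun n : ℤ => greenTerm d z l n)
  swap
  · rw [tsum_eq_zero_of_not_summable hs, abs_zero]; positivity
  have hs' : Summable (fun n : ℤ => greenTerm d z l (-n)) :=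
    (Equiv.neg ℤ).summable_iff.mpr hs
  have e1 : ∑' n : ℤ, greenTerm d z l (-n) = ∑' n : ℤ, greenTerm d z l n :=
    (Equiv.neg ℤ).tsum_eq (fun n : ℤ => greenTerm d z l n)
  have e2 : ∑' n : ℤ, (greenTerm d z l n + greenTerm d z l (-n)) =
      2 * ∑' n : ℤ, greenTerm d z l n := by
    rw [hs.tsum_add hs', e1]; ring
  have key := gaux_tsum_int (fun n : ℤ => greenTerm d z l n + greenTerm d z l (-n)) d
    (192 / d) hd0 (by positivity) (by
      intro n
      have ha := gaux_diff2 d (2 * n) (z - l) hd (by rw [abs_le]; constructor <;> linarith)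
      have hb := gaux_diff2 d (2 * n) (z + l) hd (by rw [abs_le]; constructor <;> linarith)
      have eq : greenTerm d z l n + greenTerm d z l (-n) =
          (1 / √(d ^ 2 + (2 * n + (z - l)) ^ 2) + 1 / √(d ^ 2 + (2 * n - (z - l)) ^ 2)
            - 2 / √(d ^ 2 + (2 * n) ^ 2)) -
          (1 / √(d ^ 2 + (2 * n + (z + l)) ^ 2) + 1 / √(d ^ 2 + (2 * n - (z + l)) ^ 2)
            - 2 / √(d ^ 2 + (2 * n) ^ 2)) := by
        unfold greenTerm
        push_cast
        rw [show (z - l + 2 * (n:ℝ)) ^ 2 = (2 * n + (z - l)) ^ 2 by ring,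
          show (z + l - 2 * (n:ℝ)) ^ 2 = (2 * n - (z + l)) ^ 2 by ring,
          show (z - l + 2 * -(n:ℝ)) ^ 2 = (2 * n - (z - l)) ^ 2 by ring,
          show (z + l - 2 * -(n:ℝ)) ^ 2 = (2 * n + (z + l)) ^ 2 by ring]
        ring
      simp only [eq]
      refine (abs_sub _ _).trans ((add_le_add ha hb).trans ?_)
      have hn : (2 * (n:ℝ)) ^ 2 = 4 * |(n:ℝ)| ^ 2 := by rw [sq_abs]; ring
      rw [hn]
      have hm := abs_nonneg (n:ℝ)
      set m := |(n:ℝ)|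
      have : (d + m) * (d + m + 1) ≤ 4 * (d ^ 2 + 4 * m ^ 2) := by
        nlinarith [sq_nonneg (d - m), mul_nonneg hm (sub_nonneg.mpr hd)]
      have h1 : 1 / (d ^ 2 + 4 * m ^ 2) ≤ 4 * (1 / ((d + m) * (d + m + 1))) := by
        rw [mul_one_div, div_le_div_iff₀ (by positivity) (by positivity)]
        linarith
      calc 24 / (d * (d ^ 2 + 4 * m ^ 2)) + 24 / (d * (d ^ 2 + 4 * m ^ 2))
          = 48 / d * (1 / (d ^ 2 + 4 * m ^ 2)) := by field_simp; ring
        _ ≤ 48 / d * (4 * (1 / ((d + m) * (d + m + 1)))) := by gcongr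
        _ = _ := by ring)
  rw [e2, abs_mul, abs_two] at key
  have : 2 * (192 / d) / d = 2 * (192 / d ^ 2) := by field_simp
  linarith

lemma gaux_small (d z l : ℝ) (hz : z ∈ Set.Icc (0:ℝ) 1) (hl : l ∈ Set.Icc (0:ℝ) 1)
    (hd : 0 < d) (hd1 : d < 1) : |∑' n : ℤ, greenTerm d z l n| ≤ 24 / d := by
  obtain ⟨hz0, hz1⟩ := hz
  obtain ⟨hl0, hl1⟩ := hl
  have key := gaux_tsum_int (fun n : ℤ => greenTerm d z l n) 1
    (12 / d) one_pos (by positivity) (by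
      intro n
      have h0 := abs_nonneg (n:ℝ)
      unfold greenTerm
      rcases le_or_gt |(n:ℝ)| 1 with h | h
      · have hP := gaux_le d (z - l + 2 * n)
        have hQ := gaux_le d (z + l - 2 * n)
        have i1 := one_div_le_one_div_of_le hd hP
        have i2 := one_div_le_one_div_of_le hd hQ
        have j1 : 0 ≤ 1 / √(d ^ 2 + (z - l + 2 * n) ^ 2) := by positivity
        have j2 : 0 ≤ 1 / √(d ^ 2 + (z + l - 2 * n) ^ 2) := by positivity
        set m := |(n:ℝ)|
        have : 1 / 6 ≤ 1 / ((1 + m) * (1 + m + 1)) :=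
          one_div_le_one_div_of_le (by positivity) (by nlinarith)
        calc _ ≤ 12 / d * (1 / 6) := by
              rw [abs_le]
              have : 12 / d * (1 / 6) = 2 * (1 / d) := by ring
              have : 0 < 1 / d := by positivity
              constructor <;> linarith
          _ ≤ _ := by gcongr
      · have h2 : (2:ℝ) ≤ |(n:ℝ)| := by
          have : (1:ℤ) < |n| := by exact_mod_cast h
          have : (2:ℤ) ≤ |n| := by omega
          exact_mod_cast this
        rw [show (z + l - 2 * (n:ℝ)) ^ 2 = (2 * n - (z + l)) ^ 2 by ring]
        have hP := (gaux_abs_le d (z - l + 2 * n))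
        have hQ := (gaux_abs_le d (2 * n - (z + l)))
        have g1 : 2 * |(n:ℝ)| - 1 ≤ |z - l + 2 * (n:ℝ)| := by
          have := abs_sub (z - l + 2 * (n:ℝ)) (z - l)
          rw [show z - l + 2 * (n:ℝ) - (z - l) = 2 * n by ring, abs_mul, abs_two] at this
          have : |z - l| ≤ 1 := by rw [abs_le]; constructor <;> linarith
          linarith
        have g2 : 2 * |(n:ℝ)| - 2 ≤ |2 * (n:ℝ) - (z + l)| := by
          have := abs_add_le (2 * (n:ℝ) - (z + l)) (z + l)
          rw [show 2 * (n:ℝ) - (z + l) + (z + l) = 2 * n by ring, abs_mul, abs_two] at this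
          have : |z + l| ≤ 2 := by rw [abs_le]; constructor <;> linarith
          linarith
        refine (gaux_diff1 d _ _ hd).trans ?_
        have f1 : |z - l + 2 * (n:ℝ) - (2 * n - (z + l))| ≤ 2 := by
          rw [abs_le]; constructor <;> linarith
        set m := |(n:ℝ)|
        set P := √(d ^ 2 + (z - l + 2 * n) ^ 2)
        set Q := √(d ^ 2 + (2 * n - (z + l)) ^ 2)
        have k1 : 1 + m ≤ P := by linarith
        have k2 : (1 + m + 1) / 2 ≤ Q := by linarith
        have k3 : (1 + m) * ((1 + m + 1) / 2) ≤ P * Q :=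
          mul_le_mul k1 k2 (by positivity) (by linarith)
        have k4 : (12:ℝ) ≤ 12 / d := by
          rw [le_div_iff₀ hd]; linarith
        calc _ ≤ 2 / ((1 + m) * ((1 + m + 1) / 2)) := by gcongr
          _ = 4 * (1 / ((1 + m) * (1 + m + 1))) := by field_simp; norm_num
          _ ≤ _ := by gcongr; linarith)
  calc _ ≤ _ := key
    _ = 24 / d := by ring

lemma gaux_G1 (x' y' : EuclideanSpace ℝ (Fin 2)) (z l : ℝ) (hz : z ∈ Set.Icc (0:ℝ) 1)
    (hl : l ∈ Set.Icc (0:ℝ) 1) (hd : 0 < ‖x' - y'‖) :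
    |greenG x' z y' l| ≤ 192 / ‖x' - y'‖ := by
  unfold greenG
  set d := ‖x' - y'‖
  have hpi : 1 / (4 * π) ≤ 1 := by
    rw [div_le_one (by positivity)]; linarith [Real.pi_gt_three]
  rw [abs_mul, abs_of_pos (show 0 < 1 / (4 * π) by positivity)]
  refine (mul_le_of_le_one_left (abs_nonneg _) hpi).trans ?_
  rcases lt_or_ge d 1 with h | h
  · refine (gaux_small d z l hz hl hd h).trans ?_
    gcongr; norm_num
  · refine (gaux_large d z l hz hl h).trans ?_
    gcongr; nlinarith

lemma gaux_G2 (x' y' : EuclideanSpace ℝ (Fin 2)) (z l : ℝ) (hz : z ∈ Set.Icc (0:ℝ) 1)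
    (hl : l ∈ Set.Icc (0:ℝ) 1) (hd : 1 ≤ ‖x' - y'‖) :
    |greenG x' z y' l| ≤ 192 / ‖x' - y'‖ ^ 2 := by
  unfold greenG
  set d := ‖x' - y'‖
  have hpi : 1 / (4 * π) ≤ 1 := by
    rw [div_le_one (by positivity)]; linarith [Real.pi_gt_three]
  rw [abs_mul, abs_of_pos (show 0 < 1 / (4 * π) by positivity)]
  exact (mul_le_of_le_one_left (abs_nonneg _) hpi).trans (gaux_large d z l hz hl hd)

lemma gaux_norm_sq (r ρ φ : ℝ) :
    ‖vec2 r 0 - vec2 (ρ * Real.cos φ) (ρ * Real.sin φ)‖ ^ 2 =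
      (ρ - r) ^ 2 + 2 * r * ρ * (1 - Real.cos φ) := by
  rw [EuclideanSpace.norm_sq_eq]
  simp only [vec2, Fin.sum_univ_two, Real.norm_eq_abs, sq_abs]
  simp
  linear_combination ρ ^ 2 * Real.sin_sq_add_cos_sq φ

lemma gaux_norm_ge (r ρ φ : ℝ) (hr : 0 < r) (h : |ρ - r| ≤ r / 4) :
    |ρ - r| ≤ ‖vec2 r 0 - vec2 (ρ * Real.cos φ) (ρ * Real.sin φ)‖ := by
  refine abs_le_of_sq_le_sq ?_ (norm_nonneg _)
  rw [gaux_norm_sq]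
  have := abs_le.mp h
  have h1 : 0 ≤ 1 - Real.cos φ := by linarith [Real.cos_le_one φ]
  have h2 : 0 ≤ 2 * r * ρ := by
    have : 0 ≤ ρ := by linarith
    positivity
  nlinarith [mul_nonneg h2 h1]

lemma gaux_norm_ge' (r ρ φ ψ : ℝ) (hr : 0 < r) (h : |ρ - r| ≤ r / 4)
    (h0 : 0 ≤ ψ) (h1 : ψ ≤ π) (hc : Real.cos φ = Real.cos ψ) :
    (|ρ - r| + r * ψ / 2) / 2 ≤ ‖vec2 r 0 - vec2 (ρ * Real.cos φ) (ρ * Real.sin φ)‖ := by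
  refine (le_abs_self _).trans (abs_le_of_sq_le_sq ?_ (norm_nonneg _))
  rw [gaux_norm_sq, hc, ← sq_abs (ρ - r)]
  have h2 := abs_le.mp h
  have hq := Real.cos_le_one_sub_mul_cos_sq (x := ψ) (by rwa [abs_of_nonneg h0])
  have hpi : (1:ℝ) / 12 ≤ 1 / π ^ 2 := by
    apply one_div_le_one_div_of_le (by positivity)
    nlinarith [Real.pi_lt_d2, Real.pi_pos]
  have h3 : ψ ^ 2 / 6 ≤ 1 - Real.cos ψ := by
    have : 2 / π ^ 2 * ψ ^ 2 = 2 * (1 / π ^ 2) * ψ ^ 2 := by ring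
    nlinarith [sq_nonneg ψ]
  have h4 : 3 / 2 * r ^ 2 ≤ 2 * r * ρ := by nlinarith
  have h5 : 3 / 2 * r ^ 2 * (ψ ^ 2 / 6) ≤ 2 * r * ρ * (1 - Real.cos ψ) :=
    mul_le_mul h4 h3 (by positivity) (by nlinarith [sq_nonneg r])
  nlinarith [sq_nonneg (|ρ - r| - r * ψ / 2), sq_nonneg (|ρ - r|), sq_nonneg (r * ψ)]

/-- Reduction of the angular integral to a one-sided one. -/
lemma gaux_reduce (F : ℝ → ℝ) (h : ℝ → ℝ) (hcont : ContinuousOn h (Set.Icc 0 (2 * π)))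
    (hpos : ∀ φ ∈ Set.Icc 0 (2 * π), 0 ≤ h φ)
    (h1 : ∀ φ, 0 ≤ φ → φ ≤ π → |F φ| ≤ h φ)
    (h2 : ∀ φ, π ≤ φ → φ ≤ 2 * π → |F φ| ≤ h (2 * π - φ)) :
    ∫ φ in (0:ℝ)..(2 * π), |F φ| ≤ 2 * ∫ φ in (0:ℝ)..(2 * π), h φ := by
  have hpi := Real.pi_pos
  have i1 : IntervalIntegrable h MeasureTheory.volume 0 (2 * π) := by
    apply ContinuousOn.intervalIntegrable
    rwa [Set.uIcc_of_le (by positivity)]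
  have i2 : IntervalIntegrable (fun φ => h (2 * π - φ)) MeasureTheory.volume 0 (2 * π) := by
    simpa using (i1.comp_sub_left (2 * π)).symm
  have key := intervalIntegral.norm_integral_le_of_norm_le (f := fun φ => |F φ|)
    (g := fun φ => h φ + h (2 * π - φ)) (μ := MeasureTheory.volume)
    (show (0:ℝ) ≤ 2 * π by positivity) (Filter.Eventually.of_forall (by
      intro φ hφ
      have a1 := hpos φ ⟨hφ.1.le, hφ.2⟩
      have a2 := hpos (2 * π - φ) ⟨by linarith [hφ.2], by linarith [hφ.1]⟩
      rw [Real.norm_eq_abs, abs_abs]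
      rcases le_total φ π with hh | hh
      · linarith [h1 φ hφ.1.le hh]
      · linarith [h2 φ hh hφ.2])) (i1.add i2)
  refine (le_abs_self _).trans (key.trans ?_)
  rw [intervalIntegral.integral_add i1 i2, intervalIntegral.integral_comp_sub_left]
  simp
  linarith

lemma gaux_int1 (r δ : ℝ) (hr : 0 < r) (hδ : 0 < δ) :
    ∫ φ in (0:ℝ)..(2 * π), 1 / (δ + r * φ / 2) ≤ 4 / r * Real.log (2 + r / δ) := by
  have hpi := Real.pi_pos
  have hp : ∀ φ ∈ Set.uIcc 0 (2 * π), 0 < δ + r * φ / 2 := by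
    intro φ hφ
    rw [Set.uIcc_of_le (by positivity)] at hφ
    have := hφ.1
    positivity
  have := intervalIntegral.integral_eq_sub_of_hasDerivAt
    (f := fun φ => 2 / r * Real.log (δ + r * φ / 2)) (f' := fun φ => 1 / (δ + r * φ / 2))
    (a := 0) (b := 2 * π) (by
      intro φ hφ
      have h1 : HasDerivAt (fun φ : ℝ => δ + r * φ / 2) (r / 2) φ := by
        simpa using (((hasDerivAt_id φ).const_mul r).div_const 2).const_add δ
      have h2 := (h1.log (hp φ hφ).ne').const_mul (2 / r)
      refine h2.congr_deriv ?_
      have := (hp φ hφ).ne'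
      generalize δ + r * φ / 2 = w at this
      field_simp)
    (by
      apply ContinuousOn.intervalIntegrable
      apply ContinuousOn.div (by fun_prop) (by fun_prop)
      intro φ hφ
      exact (hp φ hφ).ne')
  rw [this, ← mul_sub, ← Real.log_div (by positivity) (by positivity)]
  have e : (δ + r * (2 * π) / 2) / (δ + r * 0 / 2) = 1 + π * (r / δ) := by
    field_simp; ring
  rw [e]
  have hx : 0 < r / δ := by positivity
  have : Real.log (1 + π * (r / δ)) ≤ 2 * Real.log (2 + r / δ) := by
    have e2 : 2 * Real.log (2 + r / δ) = Real.log ((2 + r / δ) ^ 2) := by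
      rw [Real.log_pow]; norm_num
    rw [e2]
    apply Real.log_le_log (by positivity)
    nlinarith [Real.pi_lt_d2]
  calc _ ≤ 2 / r * (2 * Real.log (2 + r / δ)) := by gcongr
    _ = _ := by ring

lemma gaux_int2 (r δ : ℝ) (hr : 0 < r) (hδ : 0 < δ) :
    ∫ φ in (0:ℝ)..(2 * π), 1 / (δ + r * φ / 2) ^ 2 ≤ 2 / (r * δ) := by
  have hpi := Real.pi_pos
  have hp : ∀ φ ∈ Set.uIcc 0 (2 * π), 0 < δ + r * φ / 2 := by
    intro φ hφ
    rw [Set.uIcc_of_le (by positivity)] at hφ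
    have := hφ.1
    positivity
  have := intervalIntegral.integral_eq_sub_of_hasDerivAt
    (f := fun φ => -(2 / r) * (δ + r * φ / 2)⁻¹) (f' := fun φ => 1 / (δ + r * φ / 2) ^ 2)
    (a := 0) (b := 2 * π) (by
      intro φ hφ
      have h1 : HasDerivAt (fun φ : ℝ => δ + r * φ / 2) (r / 2) φ := by
        simpa using (((hasDerivAt_id φ).const_mul r).div_const 2).const_add δ
      have h2 := (h1.fun_inv (hp φ hφ).ne').const_mul (-(2 / r))
      refine h2.congr_deriv ?_
      have := (hp φ hφ).ne'
      generalize δ + r * φ / 2 = w at this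
      field_simp)
    (by
      apply ContinuousOn.intervalIntegrable
      apply ContinuousOn.div (by fun_prop) (by fun_prop)
      intro φ hφ
      exact pow_ne_zero 2 (hp φ hφ).ne')
  rw [this]
  have e : 2 / (r * δ) = 2 / r * (δ + r * 0 / 2)⁻¹ := by
    field_simp; simp
  have : 0 ≤ 2 / r * (δ + r * (2 * π) / 2)⁻¹ := by positivity
  rw [e]
  linarith

/-- Angular integral bounds for the Green function: with `x = (r,0,z)`
and `y(φ) = (ρ cos φ, ρ sin φ, l)`, the integral of `|G|` over `φ ∈ [0,2π]` is bounded by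
`C/(r|ρ−r|)` when `1 ≤ |ρ−r| ≤ r/4`, and by `(C/r) ln(2 + r/|ρ−r|)` when `0 < |ρ−r| < 1`. -/
theorem green_angular_integral_bound :
    ∃ C : ℝ, 0 < C ∧
      ∀ r ρ z l : ℝ, 0 < r → 0 < ρ → z ∈ Set.Icc (0:ℝ) 1 → l ∈ Set.Icc (0:ℝ) 1 →
        0 < |ρ - r| → |ρ - r| ≤ r / 4 →
        ((1 ≤ |ρ - r| →
          (∫ φ in (0:ℝ)..(2 * π),
              |greenG (vec2 r 0) z (vec2 (ρ * Real.cos φ) (ρ * Real.sin φ)) l|)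
            ≤ C / (r * |ρ - r|)) ∧
        (|ρ - r| < 1 →
          (∫ φ in (0:ℝ)..(2 * π),
              |greenG (vec2 r 0) z (vec2 (ρ * Real.cos φ) (ρ * Real.sin φ)) l|)
            ≤ (C / r) * Real.log (2 + r / |ρ - r|))) := by
  refine ⟨3072, by norm_num, ?_⟩
  intro r ρ z l hr hρ hz hl hδ hδr
  have hcos : ∀ φ : ℝ, Real.cos φ = Real.cos (2 * π - φ) := fun φ => by
    rw [Real.cos_two_pi_sub]
  have hw : ∀ φ ∈ Set.Icc 0 (2 * π), 0 < |ρ - r| + r * φ / 2 := by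
    intro φ hφ
    have := hφ.1
    positivity
  constructor
  · intro h1
    have B : ∀ φ ψ : ℝ, 0 ≤ ψ → ψ ≤ π → Real.cos φ = Real.cos ψ →
        |greenG (vec2 r 0) z (vec2 (ρ * Real.cos φ) (ρ * Real.sin φ)) l| ≤
          768 * (1 / (|ρ - r| + r * ψ / 2) ^ 2) := by
      intro φ ψ h0 hp hc
      have n1 := gaux_norm_ge r ρ φ hr hδr
      have n2 := gaux_norm_ge' r ρ φ ψ hr hδr h0 hp hc
      refine (gaux_G2 _ _ z l hz hl (h1.trans n1)).trans ?_
      have : 768 * (1 / (|ρ - r| + r * ψ / 2) ^ 2) =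
          192 / ((|ρ - r| + r * ψ / 2) / 2) ^ 2 := by field_simp; norm_num
      rw [this]
      gcongr
    refine (gaux_reduce _ (fun φ => 768 * (1 / (|ρ - r| + r * φ / 2) ^ 2)) ?_ ?_ ?_ ?_).trans ?_
    · apply ContinuousOn.mul (by fun_prop)
      apply ContinuousOn.div (by fun_prop) (by fun_prop)
      intro φ hφ
      exact pow_ne_zero 2 (hw φ hφ).ne'
    · intro φ hφ
      positivity
    · intro φ a b
      exact B φ φ a b rfl
    · intro φ a b
      exact B φ (2 * π - φ) (by linarith) (by linarith) (hcos φ)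
    · rw [intervalIntegral.integral_const_mul]
      have := gaux_int2 r |ρ - r| hr hδ
      have e : 3072 / (r * |ρ - r|) = 2 * (768 * (2 / (r * |ρ - r|))) := by ring
      rw [e]
      linarith
  · intro h1
    have B : ∀ φ ψ : ℝ, 0 ≤ ψ → ψ ≤ π → Real.cos φ = Real.cos ψ →
        |greenG (vec2 r 0) z (vec2 (ρ * Real.cos φ) (ρ * Real.sin φ)) l| ≤
          384 * (1 / (|ρ - r| + r * ψ / 2)) := by
      intro φ ψ h0 hp hc
      have n1 := gaux_norm_ge r ρ φ hr hδr
      have n2 := gaux_norm_ge' r ρ φ ψ hr hδr h0 hp hc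
      refine (gaux_G1 _ _ z l hz hl (hδ.trans_le n1)).trans ?_
      have : 384 * (1 / (|ρ - r| + r * ψ / 2)) =
          192 / ((|ρ - r| + r * ψ / 2) / 2) := by field_simp; norm_num
      rw [this]
      gcongr
    refine (gaux_reduce _ (fun φ => 384 * (1 / (|ρ - r| + r * φ / 2))) ?_ ?_ ?_ ?_).trans ?_
    · apply ContinuousOn.mul (by fun_prop)
      apply ContinuousOn.div (by fun_prop) (by fun_prop)
      intro φ hφ
      exact (hw φ hφ).ne'
    · intro φ hφ
      have := hw φ hφ
      positivity
    · intro φ a b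
      exact B φ φ a b rfl
    · intro φ a b
      exact B φ (2 * π - φ) (by linarith) (by linarith) (hcos φ)
    · rw [intervalIntegral.integral_const_mul]
      have := gaux_int1 r |ρ - r| hr hδ
      have e : 3072 / r * Real.log (2 + r / |ρ - r|) =
          2 * (384 * (4 / r * Real.log (2 + r / |ρ - r|))) := by ring
      rw [e]
      linarith
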